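/- arXiv:2104.12236 — 2 statements merged into one kernel-verified Lean document; each statement's English description precedes it below -/
import Mathlib

section
/- Interior Carleman estimate: Let n ≥ 2, let Ω ⊂ ℝⁿ be a bounded open set, T > 0, Q = (0,T)×Ω, and let (A,q) ∈ 𝓜(m) with A real-valued. Let ω ∈ ℝⁿ be a unit vector and set φ(t,x) = λ²t + λ x·ω. Then there exist constants λ₁ > 0 and C > 0, depending only on m and Q, such that for every complex-valued u ∈ C_c^∞(Q) and every λ ≥ λ₁ one has ∫_Q e^{−2φ(t,x)} ( λ²|u(t,x)|² + |∇ₓu(t,x)|² ) dx dt ≤ C ∫_Q e^{−2φ(t,x)} |𝓛_{A,q}u(t,x)|² dx dt. -/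
open MeasureTheory Set

/-- Partial derivative in time of a function on `ℝ × ℝⁿ`. -/
noncomputable def timeDeriv {n : ℕ} (f : ℝ × (Fin n → ℝ) → ℂ) (p : ℝ × (Fin n → ℝ)) : ℂ :=
  deriv (fun t => f (t, p.2)) p.1

/-- Partial derivative in the `j`-th space variable of a function on `ℝ × ℝⁿ`. -/
noncomputable def spDeriv {n : ℕ} (j : Fin n) (f : ℝ × (Fin n → ℝ) → ℂ)
    (p : ℝ × (Fin n → ℝ)) : ℂ :=
  deriv (fun s => f (p.1, Function.update p.2 j s)) (p.2 j)

/-- The convection–diffusion operator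
`𝓛_{A,q} u = ∂ₜu − Σⱼ (∂ⱼ + Aⱼ)² u + q u`, where
`(∂ⱼ + Aⱼ)² u = ∂ⱼ²u + 2Aⱼ∂ⱼu + (∂ⱼAⱼ)u + Aⱼ²u`. -/
noncomputable def LOp {n : ℕ} (A : ℝ × (Fin n → ℝ) → Fin n → ℝ) (q u : ℝ × (Fin n → ℝ) → ℂ)
    (p : ℝ × (Fin n → ℝ)) : ℂ :=
  timeDeriv u p
    - ∑ j, (spDeriv j (spDeriv j u) p
        + 2 * (A p j : ℂ) * spDeriv j u p
        + spDeriv j (fun p' => (A p' j : ℂ)) p * u p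
        + (A p j : ℂ) ^ 2 * u p)
    + q p * u p

/-- The admissible class `𝓜(m)`: `A ∈ W^{2,∞}(Q)ⁿ`, `q ∈ W^{1,∞}(Q)` with
`‖A‖_{W^{2,∞}(Q)} + ‖q‖_{W^{1,∞}(Q)} ≤ m`. -/
def MemM (n : ℕ) (m : ℝ) (Q : Set (ℝ × (Fin n → ℝ)))
    (A : ℝ × (Fin n → ℝ) → Fin n → ℝ) (q : ℝ × (Fin n → ℝ) → ℂ) : Prop :=
  ContDiffOn ℝ 2 A Q ∧ ContDiffOn ℝ 1 q Q ∧
    ∀ p ∈ Q,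
      (∑ k ∈ Finset.range 3, ‖iteratedFDerivWithin ℝ k A Q p‖)
        + (∑ k ∈ Finset.range 2, ‖iteratedFDerivWithin ℝ k q Q p‖) ≤ m

/-- The Carleman weight `φ(t,x) = λ² t + λ x·ω`. -/
noncomputable def phiW {n : ℕ} (lam : ℝ) (ω : Fin n → ℝ) (p : ℝ × (Fin n → ℝ)) : ℝ :=
  lam ^ 2 * p.1 + lam * ∑ j, p.2 j * ω j

namespace Carl

/-- directional derivative -/
noncomputable def D {E : Type*} [NormedAddCommGroup E] [NormedSpace ℝ E] (a : E) (f : E → ℝ) (p : E) : ℝ :=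
  fderiv ℝ f p a

/-- test functions -/
def TF {E : Type*} [NormedAddCommGroup E] [NormedSpace ℝ E] (f : E → ℝ) : Prop :=
  ContDiff ℝ (⊤ : ℕ∞) f ∧ HasCompactSupport f

set_option linter.unusedSectionVars false

section
variable {E : Type*} [NormedAddCommGroup E] [NormedSpace ℝ E]

lemma smooth_D {f : E → ℝ} (hf : ContDiff ℝ (⊤ : ℕ∞) f) (a : E) : ContDiff ℝ (⊤ : ℕ∞) (D a f) := by
  unfold D
  exact (hf.fderiv_right (m := (⊤ : ℕ∞)) (by norm_cast)).clm_apply contDiff_const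

lemma diffAt {f : E → ℝ} (hf : ContDiff ℝ (⊤ : ℕ∞) f) (p : E) : DifferentiableAt ℝ f p :=
  (hf.differentiable (by simp)).differentiableAt

lemma D_add {f g : E → ℝ} (hf : ContDiff ℝ (⊤ : ℕ∞) f) (hg : ContDiff ℝ (⊤ : ℕ∞) g) (a p : E) :
    D a (fun p => f p + g p) p = D a f p + D a g p := by
  unfold D
  rw [fderiv_fun_add (diffAt hf p) (diffAt hg p)]; rfl

lemma D_sub {f g : E → ℝ} (hf : ContDiff ℝ (⊤ : ℕ∞) f) (hg : ContDiff ℝ (⊤ : ℕ∞) g) (a p : E) :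
    D a (fun p => f p - g p) p = D a f p - D a g p := by
  unfold D
  rw [fderiv_fun_sub (diffAt hf p) (diffAt hg p)]; rfl

lemma D_mul {f g : E → ℝ} (hf : ContDiff ℝ (⊤ : ℕ∞) f) (hg : ContDiff ℝ (⊤ : ℕ∞) g) (a p : E) :
    D a (fun p => f p * g p) p = f p * D a g p + D a f p * g p := by
  unfold D
  rw [fderiv_fun_mul (diffAt hf p) (diffAt hg p)]
  simp [mul_comm]

lemma D_const (c : ℝ) (a p : E) : D a (fun _ => c) p = 0 := by
  simp [D]

lemma D_exp {f : E → ℝ} (hf : ContDiff ℝ (⊤ : ℕ∞) f) (a p : E) :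
    D a (fun p => Real.exp (f p)) p = Real.exp (f p) * D a f p := by
  unfold D
  rw [fderiv_exp (diffAt hf p)]; simp

lemma D_comm {f : E → ℝ} (hf : ContDiff ℝ (⊤ : ℕ∞) f) (a b p : E) :
    D a (D b f) p = D b (D a f) p := by
  have h2 : DifferentiableAt ℝ (fderiv ℝ f) p :=
    ((hf.fderiv_right (m := (⊤ : ℕ∞)) (by norm_cast)).differentiable (by simp)).differentiableAt
  have hs : IsSymmSndFDerivAt ℝ f p := (hf.contDiffAt).isSymmSndFDerivAt (by
    simp only [minSmoothness_of_isRCLikeNormedField]; exact WithTop.coe_le_coe.2 (le_top : (2 : ℕ∞) ≤ ⊤))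
  have key : ∀ a b, D a (D b f) p = fderiv ℝ (fderiv ℝ f) p a b := by
    intro a b
    unfold D
    rw [fderiv_clm_apply h2 (differentiableAt_const b)]
    simp
  rw [key, key]; exact hs.eq a b

lemma TF.D {f : E → ℝ} (hf : TF f) (a : E) : TF (D a f) :=
  ⟨smooth_D hf.1 a, hf.2.fderiv_apply (𝕜 := ℝ) a⟩

lemma TF.add {f g : E → ℝ} (hf : TF f) (hg : TF g) : TF (fun p => f p + g p) :=
  ⟨hf.1.add hg.1, hf.2.add hg.2⟩

lemma TF.mul_left {f g : E → ℝ} (hf : ContDiff ℝ (⊤ : ℕ∞) f) (hg : TF g) : TF (fun p => f p * g p) :=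
  ⟨hf.mul hg.1, hg.2.mul_left⟩

lemma TF.mul {f g : E → ℝ} (hf : TF f) (hg : TF g) : TF (fun p => f p * g p) :=
  TF.mul_left hf.1 hg

lemma TF.sum {ι : Type*} (s : Finset ι) {f : ι → E → ℝ} (hf : ∀ i, TF (f i)) :
    TF (fun p => ∑ i ∈ s, f i p) := by
  classical
  induction s using Finset.induction_on with
  | empty => exact ⟨by simpa using contDiff_const, by
      simp only [Finset.sum_empty]; exact HasCompactSupport.zero⟩
  | insert i s hi ih => simpa [Finset.sum_insert hi] using (hf i).add ih

variable [MeasurableSpace E] [BorelSpace E] [FiniteDimensional ℝ E] (μ : Measure E) [μ.IsAddHaarMeasure]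

lemma TF.int {f : E → ℝ} (hf : TF f) : Integrable f μ :=
  hf.1.continuous.integrable_of_hasCompactSupport hf.2

lemma int_D {f : E → ℝ} (hf : TF f) (a : E) : ∫ p, D a f p ∂μ = 0 := by
  have := integral_mul_fderiv_eq_neg_fderiv_mul_of_integrable (μ := μ) (f := fun _ => (1:ℝ)) (g := f) (v := a)
    (by simp) (by simp only [one_mul]; exact (hf.D a).int μ) (by simpa using hf.int μ)
    (by fun_prop) (fun x _ => diffAt hf.1 x)
  simpa [D] using this

end

section base
variable {n : ℕ}

instance haarX : (volume : Measure (ℝ × (Fin n → ℝ))).IsAddHaarMeasure :=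
  inferInstanceAs ((volume : Measure ℝ).prod (volume : Measure (Fin n → ℝ))).IsAddHaarMeasure

/-- y = x·ω -/
noncomputable def yy (ω : Fin n → ℝ) (p : ℝ × (Fin n → ℝ)) : ℝ := ∑ j, p.2 j * ω j
noncomputable def hh (s l : ℝ) (ω : Fin n → ℝ) (p : ℝ × (Fin n → ℝ)) : ℝ := l - s * yy ω p
noncomputable def psi (s l : ℝ) (ω : Fin n → ℝ) (p : ℝ × (Fin n → ℝ)) : ℝ :=
  l ^ 2 * p.1 + l * yy ω p - s / 2 * (yy ω p * yy ω p)
noncomputable def ej (j : Fin n) : ℝ × (Fin n → ℝ) := (0, Pi.single j 1)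
noncomputable def et : ℝ × (Fin n → ℝ) := (1, 0)
noncomputable def eo (ω : Fin n → ℝ) : ℝ × (Fin n → ℝ) := (0, ω)

variable (s l : ℝ) (ω : Fin n → ℝ)

lemma smooth_yy : ContDiff ℝ (⊤ : ℕ∞) (yy ω) := by unfold yy; fun_prop
lemma smooth_hh : ContDiff ℝ (⊤ : ℕ∞) (hh s l ω) := by
  unfold hh; exact contDiff_const.sub (contDiff_const.mul (smooth_yy ω))
lemma smooth_psi : ContDiff ℝ (⊤ : ℕ∞) (psi s l ω) := by
  have := smooth_yy ω
  unfold psi; fun_prop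

lemma D_yy (a p : (ℝ × (Fin n → ℝ))) : D a (yy ω) p = yy ω a := by
  have h : IsBoundedLinearMap ℝ (yy ω) := by
    have : IsLinearMap ℝ (yy ω) := by
      constructor
      · intro x y; simp [yy, add_mul, Finset.sum_add_distrib]
      · intro c x; simp [yy, Finset.mul_sum, mul_assoc]
    exact this.mk'.toContinuousLinearMap.isBoundedLinearMap
  unfold D
  rw [h.fderiv]; rfl

lemma D_fst (a p : (ℝ × (Fin n → ℝ))) : D a (fun p : (ℝ × (Fin n → ℝ)) => p.1) p = a.1 := by
  unfold D
  rw [fderiv_fst]; rfl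

lemma D_hh (a p : (ℝ × (Fin n → ℝ))) : D a (hh s l ω) p = - s * yy ω a := by
  unfold hh
  rw [D_sub contDiff_const (contDiff_const.mul (smooth_yy ω)), D_mul contDiff_const (smooth_yy ω), D_const, D_const, D_yy]
  ring

lemma D_psi (a p : (ℝ × (Fin n → ℝ))) : D a (psi s l ω) p = l ^ 2 * a.1 + hh s l ω p * yy ω a := by
  have hy := smooth_yy ω
  unfold psi
  rw [D_sub (by fun_prop) (by fun_prop), D_add (by fun_prop) (by fun_prop), D_mul (by fun_prop) (by fun_prop),
    D_mul (by fun_prop) (by fun_prop), D_mul (by fun_prop) (by fun_prop), D_mul (by fun_prop) (by fun_prop)]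
  simp only [D_const, D_yy, D_fst, hh]
  ring

@[simp] lemma yy_ej (j : Fin n) : yy ω (ej j) = ω j := by
  simp [yy, ej, Pi.single_apply]
@[simp] lemma yy_et : yy ω et = 0 := by simp [yy, et]
lemma yy_eo (hω : ∑ j, ω j ^ 2 = 1) : yy ω (eo ω) = 1 := by
  rw [← hω]; simp [yy, eo, sq]
@[simp] lemma ej_fst (j : Fin n) : (ej j).1 = 0 := rfl
@[simp] lemma et_fst : (et : (ℝ × (Fin n → ℝ))).1 = 1 := rfl

lemma D_eo (f : (ℝ × (Fin n → ℝ)) → ℝ) (p : (ℝ × (Fin n → ℝ))) : D (eo ω) f p = ∑ j, ω j * D (ej j) f p := by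
  unfold D
  have : eo ω = ∑ j, ω j • ej j := by
    ext i
    · simp [eo, ej, Prod.fst_sum]
    · simp [eo, ej, Prod.snd_sum, Finset.sum_apply, Pi.single_apply]
  rw [this, map_sum]; simp

noncomputable def P2 (v : (ℝ × (Fin n → ℝ)) → ℝ) (p : (ℝ × (Fin n → ℝ))) : ℝ :=
  D et v p - 2 * hh s l ω p * D (eo ω) v p + s * v p
noncomputable def Pf (v : (ℝ × (Fin n → ℝ)) → ℝ) (p : (ℝ × (Fin n → ℝ))) : ℝ :=
  - (∑ j, D (ej j) (D (ej j) v) p) + (l ^ 2 - hh s l ω p ^ 2) * v p + P2 s l ω v p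

lemma TF.P2 {v : (ℝ × (Fin n → ℝ)) → ℝ} (hv : TF v) : TF (P2 s l ω v) := by
  unfold Carl.P2
  have h := smooth_hh s l ω
  have h1 : TF (fun p => (-(2 * hh s l ω p)) * Carl.D (eo ω) v p) :=
    TF.mul_left (by fun_prop) (hv.D _)
  have h2 : TF (fun p => s * v p) := TF.mul_left (by fun_prop) hv
  convert ((hv.D et).add h1).add h2 using 2
  ring

lemma TF.Pf {v : (ℝ × (Fin n → ℝ)) → ℝ} (hv : TF v) : TF (Pf s l ω v) := by
  unfold Carl.Pf
  have h := smooth_hh s l ω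
  have h1 : TF (fun p => (l ^ 2 - hh s l ω p ^ 2) * v p) :=
    TF.mul_left (by fun_prop) hv
  have h2 : TF (fun p => (-1) * ∑ j, Carl.D (ej j) (Carl.D (ej j) v) p) :=
    TF.mul_left contDiff_const (TF.sum _ fun j => (hv.D _).D _)
  convert (h2.add h1).add (hv.P2 s l ω) using 2
  ring

lemma int_c (hω : ∑ j, ω j ^ 2 = 1) {v : (ℝ × (Fin n → ℝ)) → ℝ} (hv : TF v) (j : Fin n) :
    ∫ p, (-(D (ej j) (D (ej j) v) p * P2 s l ω v p) - 2 * s * (ω j * D (ej j) v p * D (eo ω) v p)) = 0 := by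
  have hj := hv.D (ej j)
  have hh' := smooth_hh s l ω
  have F1 : TF (fun p => D (ej j) v p * P2 s l ω v p) := hj.mul (hv.P2 s l ω)
  have F2 : TF (fun p => D (ej j) v p * D (ej j) v p) := hj.mul hj
  have F3 : TF (fun p => hh s l ω p * (D (ej j) v p * D (ej j) v p)) := TF.mul_left hh' F2
  have key : ∀ p, (-(D (ej j) (D (ej j) v) p * P2 s l ω v p) - 2 * s * (ω j * D (ej j) v p * D (eo ω) v p))
    = (-1) * D (ej j) (fun p => D (ej j) v p * P2 s l ω v p) p
      + ((1/2) * D et (fun p => D (ej j) v p * D (ej j) v p) p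
      + (-1) * D (eo ω) (fun p => hh s l ω p * (D (ej j) v p * D (ej j) v p)) p) := by
    intro p
    have e1 : D (ej j) (P2 s l ω v) p = D et (D (ej j) v) p - 2 * hh s l ω p * D (eo ω) (D (ej j) v) p
        + 2 * s * ω j * D (eo ω) v p + s * D (ej j) v p := by
      unfold P2
      have a1 := (hv.D et).1
      have a2 := (hv.D (eo ω)).1
      have a3 := hv.1
      rw [D_add (by fun_prop) (by fun_prop), D_sub (by fun_prop) (by fun_prop), D_mul (by fun_prop) (by fun_prop),
        D_mul (by fun_prop) (by fun_prop), D_mul (by fun_prop) (by fun_prop), D_hh, D_const, D_const,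
        D_comm hv.1 et, D_comm hv.1 (eo ω), yy_ej]
      ring
    rw [D_mul hj.1 (hv.P2 s l ω).1, e1, D_mul hj.1 hj.1, D_mul hh' F2.1, D_mul hj.1 hj.1, D_hh, yy_eo ω hω]
    ring
  simp_rw [key]
  rw [integral_add, integral_add, integral_const_mul, integral_const_mul, integral_const_mul, int_D _ F1, int_D _ F2, int_D _ F3]
  · simp
  · exact ((F2.D _).int _).const_mul _
  · exact ((F3.D _).int _).const_mul _
  · exact ((F1.D _).int _).const_mul _
  · exact (((F2.D _).int _).const_mul _).add (((F3.D _).int _).const_mul _)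

lemma int_d (hω : ∑ j, ω j ^ 2 = 1) {v : (ℝ × (Fin n → ℝ)) → ℝ} (hv : TF v) :
    ∫ p, ((l ^ 2 - hh s l ω p ^ 2) * v p * P2 s l ω v p - 2 * s * (hh s l ω p * hh s l ω p * (v p * v p))) = 0 := by
  have hh' := smooth_hh s l ω
  have F0 := hv.mul hv
  have F2 : TF (fun p => (l ^ 2 - hh s l ω p * hh s l ω p) * (v p * v p)) := TF.mul_left (by fun_prop) F0
  have F3 : TF (fun p => hh s l ω p * ((l ^ 2 - hh s l ω p * hh s l ω p) * (v p * v p))) := TF.mul_left hh' F2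
  have key : ∀ p, ((l ^ 2 - hh s l ω p ^ 2) * v p * P2 s l ω v p - 2 * s * (hh s l ω p * hh s l ω p * (v p * v p)))
    = (1/2) * D et (fun p => (l ^ 2 - hh s l ω p * hh s l ω p) * (v p * v p)) p
      + (-1) * D (eo ω) (fun p => hh s l ω p * ((l ^ 2 - hh s l ω p * hh s l ω p) * (v p * v p))) p := by
    intro p
    have e1 : ∀ a, D a (fun p => (l ^ 2 - hh s l ω p * hh s l ω p) * (v p * v p)) p =
      (l ^ 2 - hh s l ω p * hh s l ω p) * (2 * v p * D a v p) + 2 * s * yy ω a * hh s l ω p * (v p * v p) := by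
      intro a
      rw [D_mul (by fun_prop) F0.1, D_sub (by fun_prop) (by fun_prop), D_mul hh' hh', D_mul hv.1 hv.1, D_const, D_hh]
      ring
    rw [D_mul hh' F2.1, e1, e1, D_hh, yy_eo ω hω, yy_et, P2]
    ring
  simp_rw [key]
  rw [integral_add, integral_const_mul, integral_const_mul, int_D _ F2, int_D _ F3]
  · simp
  · exact ((F2.D _).int _).const_mul _
  · exact ((F3.D _).int _).const_mul _

/-- first identity -/
lemma ident1 (hω : ∑ j, ω j ^ 2 = 1) {v : (ℝ × (Fin n → ℝ)) → ℝ} (hv : TF v) :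
    ∫ p, (Pf s l ω v p * P2 s l ω v p - P2 s l ω v p * P2 s l ω v p
      - 2 * s * (D (eo ω) v p * D (eo ω) v p) - 2 * s * (hh s l ω p * hh s l ω p * (v p * v p))) = 0 := by
  have hh' := smooth_hh s l ω
  have hP := hv.P2 s l ω
  have key : ∀ p, (Pf s l ω v p * P2 s l ω v p - P2 s l ω v p * P2 s l ω v p
      - 2 * s * (D (eo ω) v p * D (eo ω) v p) - 2 * s * (hh s l ω p * hh s l ω p * (v p * v p)))
      = (∑ j, (-(D (ej j) (D (ej j) v) p * P2 s l ω v p) - 2 * s * (ω j * D (ej j) v p * D (eo ω) v p)))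
      + ((l ^ 2 - hh s l ω p ^ 2) * v p * P2 s l ω v p - 2 * s * (hh s l ω p * hh s l ω p * (v p * v p))) := by
    intro p
    rw [Finset.sum_sub_distrib, ← Finset.mul_sum, ← Finset.sum_mul, ← D_eo, Finset.sum_neg_distrib, ← Finset.sum_mul, Pf]
    ring
  simp_rw [key]
  have i1 : ∀ j, Integrable (fun p => (-(D (ej j) (D (ej j) v) p * P2 s l ω v p) - 2 * s * (ω j * D (ej j) v p * D (eo ω) v p))) := by
    intro j
    have t1 := (((hv.D (ej j)).D (ej j)).mul hP).int volume
    have t2 := ((TF.mul_left (f := fun _ => ω j) contDiff_const (hv.D (ej j))).mul (hv.D (eo ω))).int volume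
    exact t1.neg.sub (t2.const_mul _)
  have i2 : Integrable (fun p => (l ^ 2 - hh s l ω p ^ 2) * v p * P2 s l ω v p - 2 * s * (hh s l ω p * hh s l ω p * (v p * v p))) := by
    have t1 := ((TF.mul_left (f := fun p => l ^ 2 - hh s l ω p ^ 2) (by fun_prop) hv).mul hP).int volume
    have t2 := (TF.mul_left (f := fun p => hh s l ω p * hh s l ω p) (by fun_prop) (hv.mul hv)).int volume
    exact t1.sub (t2.const_mul _)
  rw [integral_add (integrable_finsetSum _ fun j _ => i1 j) i2, integral_finsetSum _ fun j _ => i1 j, int_d s l ω hω hv]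
  simp [int_c s l ω hω hv]

/-- second identity -/
lemma ident2 (hω : ∑ j, ω j ^ 2 = 1) {v : (ℝ × (Fin n → ℝ)) → ℝ} (hv : TF v) :
    ∫ p, (Pf s l ω v p * v p - (∑ j, D (ej j) v p * D (ej j) v p)
      - (l ^ 2 - hh s l ω p ^ 2) * (v p * v p)) = 0 := by
  have hh' := smooth_hh s l ω
  have F0 := hv.mul hv
  have F1 : ∀ j, TF (fun p => D (ej j) v p * v p) := fun j => (hv.D _).mul hv
  have F3 : TF (fun p => hh s l ω p * (v p * v p)) := TF.mul_left hh' F0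
  have key : ∀ p, (Pf s l ω v p * v p - (∑ j, D (ej j) v p * D (ej j) v p)
      - (l ^ 2 - hh s l ω p ^ 2) * (v p * v p))
    = (∑ j, (-1) * D (ej j) (fun p => D (ej j) v p * v p) p)
      + ((1/2) * D et (fun p => v p * v p) p
      + (-1) * D (eo ω) (fun p => hh s l ω p * (v p * v p)) p) := by
    intro p
    rw [D_mul hv.1 hv.1, D_mul hh' F0.1, D_mul hv.1 hv.1, D_hh, yy_eo ω hω, Pf, P2]
    simp_rw [fun j => D_mul (hv.D (ej j)).1 hv.1 (ej j) p]
    rw [← Finset.mul_sum, Finset.sum_add_distrib, ← Finset.sum_mul]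
    ring
  simp_rw [key]
  have j1 := fun j => (((F1 j).D (ej j)).int volume).const_mul (-1)
  have j2 := ((F0.D et).int volume).const_mul (1/2)
  have j3 := ((F3.D (eo ω)).int volume).const_mul (-1)
  have j23 : Integrable (fun p => (1/2) * D et (fun p => v p * v p) p
      + (-1) * D (eo ω) (fun p => hh s l ω p * (v p * v p)) p) := j2.add j3
  rw [integral_add (integrable_finsetSum _ fun j _ => j1 j) j23, integral_finsetSum _ fun j _ => j1 j,
    integral_add j2 j3, integral_const_mul, integral_const_mul, int_D _ F0, int_D _ F3]
  simp_rw [integral_const_mul, fun j => int_D volume (F1 j) (ej j)]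
  simp

/-- Estimate for the conjugated operator. -/
lemma conj_est (hω : ∑ j, ω j ^ 2 = 1) (hs : 1 ≤ s) (hl : 1 ≤ l) (hl2 : 4 * s ≤ l ^ 2)
    {v : (ℝ × (Fin n → ℝ)) → ℝ} (hv : TF v) (hsupp : ∀ p, v p ≠ 0 → l ≤ 2 * hh s l ω p) :
    s * ∫ p, (l ^ 2 * v p ^ 2 + ∑ j, (D (ej j) v p + hh s l ω p * ω j * v p) ^ 2) ≤
      4 * ∫ p, (Pf s l ω v p) ^ 2 := by
  have hh' := smooth_hh s l ω
  have hP := hv.P2 s l ω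
  have hQ := hv.Pf s l ω
  have i1 := ident1 s l ω hω hv
  have i2 := ident2 s l ω hω hv
  have Tv2 : TF (fun p => hh s l ω p * hh s l ω p * (v p * v p)) := TF.mul_left (by fun_prop) (hv.mul hv)
  have TG : TF (fun p => ∑ j, D (ej j) v p * D (ej j) v p) := TF.sum _ fun j => (hv.D _).mul (hv.D _)
  have I1 : Integrable (fun p => (Pf s l ω v p * P2 s l ω v p - P2 s l ω v p * P2 s l ω v p
      - 2 * s * (D (eo ω) v p * D (eo ω) v p) - 2 * s * (hh s l ω p * hh s l ω p * (v p * v p)))) :=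
    ((((hQ.mul hP).int _).sub ((hP.mul hP).int _)).sub ((((hv.D (eo ω)).mul (hv.D (eo ω))).int _).const_mul _)).sub
      ((Tv2.int _).const_mul _)
  have I2 : Integrable (fun p => (Pf s l ω v p * v p - (∑ j, D (ej j) v p * D (ej j) v p)
      - (l ^ 2 - hh s l ω p ^ 2) * (v p * v p))) :=
    (((hQ.mul hv).int _).sub (TG.int _)).sub
      ((TF.mul_left (f := fun p => l ^ 2 - hh s l ω p ^ 2) (by fun_prop) (hv.mul hv)).int _)
  have I3 : Integrable (fun p => (Pf s l ω v p) ^ 2) := by simpa [sq] using (hQ.mul hQ).int volume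
  have I4 : Integrable (fun p => l ^ 2 * v p ^ 2 + ∑ j, (D (ej j) v p + hh s l ω p * ω j * v p) ^ 2) := by
    have a1 : TF (fun p => l ^ 2 * (v p * v p)) := TF.mul_left contDiff_const (hv.mul hv)
    have a2 : ∀ j, TF (fun p => D (ej j) v p + hh s l ω p * ω j * v p) := fun j =>
      (hv.D _).add (TF.mul_left (f := fun p => hh s l ω p * ω j) (by fun_prop) hv)
    simpa [sq] using (a1.add (TF.sum Finset.univ fun j => (a2 j).mul (a2 j))).int volume
  -- pointwise inequality
  have key : ∀ p, s * (l ^ 2 * v p ^ 2 + ∑ j, (D (ej j) v p + hh s l ω p * ω j * v p) ^ 2) ≤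
      4 * (Pf s l ω v p) ^ 2
      - 10 * (Pf s l ω v p * P2 s l ω v p - P2 s l ω v p * P2 s l ω v p
      - 2 * s * (D (eo ω) v p * D (eo ω) v p) - 2 * s * (hh s l ω p * hh s l ω p * (v p * v p)))
      - s * (Pf s l ω v p * v p - (∑ j, D (ej j) v p * D (ej j) v p)
      - (l ^ 2 - hh s l ω p ^ 2) * (v p * v p)) := by
    intro p
    have eD := D_eo ω v p
    have eS : ∑ j, (D (ej j) v p + hh s l ω p * ω j * v p) ^ 2 =
        (∑ j, D (ej j) v p * D (ej j) v p) + 2 * hh s l ω p * v p * D (eo ω) v p + hh s l ω p ^ 2 * v p ^ 2 := by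
      rw [eD]
      have : hh s l ω p ^ 2 * v p ^ 2 = hh s l ω p ^ 2 * v p ^ 2 * ∑ j, ω j ^ 2 := by rw [hω, mul_one]
      rw [this, Finset.mul_sum, Finset.mul_sum, ← Finset.sum_add_distrib, ← Finset.sum_add_distrib]
      refine Finset.sum_congr rfl fun j _ => ?_
      ring
    have hl4 : l ^ 2 * v p ^ 2 ≤ 4 * (hh s l ω p ^ 2 * v p ^ 2) := by
      by_cases h0 : v p = 0
      · simp [h0]
      · have h1 := hsupp p h0
        have : l ^ 2 ≤ 4 * hh s l ω p ^ 2 := by nlinarith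
        nlinarith [mul_le_mul_of_nonneg_right this (sq_nonneg (v p))]
    have hs4 : s * v p ^ 2 ≤ hh s l ω p ^ 2 * v p ^ 2 := by
      nlinarith [mul_le_mul_of_nonneg_right hl2 (sq_nonneg (v p))]
    rw [eS]
    generalize (∑ j, D (ej j) v p * D (ej j) v p) = G
    generalize D (eo ω) v p = d at *
    generalize Pf s l ω v p = P
    generalize P2 s l ω v p = Z
    have hs0 : 0 ≤ s := by linarith
    have m1 := mul_le_mul_of_nonneg_left hl4 hs0
    have m2 := mul_le_mul_of_nonneg_left hs4 hs0
    have m3 := mul_nonneg hs0 (sq_nonneg (d - hh s l ω p * v p))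
    have m4 := mul_nonneg hs0 (sq_nonneg d)
    have m5 := mul_nonneg hs0 (sq_nonneg (hh s l ω p * v p))
    have m6 : 0 ≤ s * (l ^ 2 * v p ^ 2) := by positivity
    nlinarith [sq_nonneg (Z - P / 2), sq_nonneg (P - s * v p / 3)]
  have := integral_mono (I4.const_mul s) (((I3.const_mul 4).sub (I1.const_mul 10)).sub (I2.const_mul s)) key
  rw [integral_const_mul] at this
  refine this.trans (le_of_eq ?_)
  have e1 := integral_sub ((I3.const_mul 4).sub (I1.const_mul 10)) (I2.const_mul s)
  have e2 := integral_sub (I3.const_mul 4) (I1.const_mul 10)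
  simp only [Pi.sub_apply] at e1 ⊢
  rw [e1, e2, integral_const_mul, integral_const_mul, integral_const_mul, i1, i2]
  ring

/-- Carleman estimate for real functions. -/
lemma real_est (hω : ∑ j, ω j ^ 2 = 1) (hs : 1 ≤ s) (hl : 1 ≤ l) (hl2 : 4 * s ≤ l ^ 2)
    {u : (ℝ × (Fin n → ℝ)) → ℝ} (hu : TF u) (hsupp : ∀ p, u p ≠ 0 → l ≤ 2 * hh s l ω p) :
    s * ∫ p, Real.exp (-2 * psi s l ω p) * (l ^ 2 * u p ^ 2 + ∑ j, (D (ej j) u p) ^ 2) ≤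
      4 * ∫ p, Real.exp (-2 * psi s l ω p) * (D et u p - ∑ j, D (ej j) (D (ej j) u) p) ^ 2 := by
  have hpsi := smooth_psi s l ω
  have hh' := smooth_hh s l ω
  have hE : ContDiff ℝ (⊤ : ℕ∞) (fun p => Real.exp (psi s l ω p)) := hpsi.exp
  obtain ⟨v, hvdef⟩ : ∃ v : (ℝ × (Fin n → ℝ)) → ℝ, v = fun p => Real.exp (-psi s l ω p) * u p := ⟨_, rfl⟩
  have hv : TF v := by rw [hvdef]; exact TF.mul_left hpsi.neg.exp hu
  have huv : u = fun p => Real.exp (psi s l ω p) * v p := by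
    funext p; rw [hvdef]; simp only; rw [← mul_assoc, ← Real.exp_add]; simp
  have hest := conj_est s l ω hω hs hl hl2 hv (by
    intro p hp; apply hsupp; intro h; apply hp; rw [hvdef]; simp [h])
  have dj : ∀ j, D (ej j) u = fun p => Real.exp (psi s l ω p) * (D (ej j) v p + hh s l ω p * ω j * v p) := by
    intro j; funext p
    rw [huv, D_mul hE hv.1, D_exp hpsi, D_psi]
    simp only [yy_ej, ej_fst]
    ring
  have dt : ∀ p, D et u p = Real.exp (psi s l ω p) * (D et v p + l ^ 2 * v p) := by
    intro p
    rw [huv, D_mul hE hv.1, D_exp hpsi, D_psi]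
    simp only [yy_et, et_fst]
    ring
  have djj : ∀ j p, D (ej j) (D (ej j) u) p = Real.exp (psi s l ω p) *
      (D (ej j) (D (ej j) v) p + 2 * hh s l ω p * (ω j * D (ej j) v p) + (hh s l ω p ^ 2 - s) * v p * ω j ^ 2) := by
    intro j p
    have a1 := (hv.D (ej j)).1
    have a2 := hv.1
    rw [dj, D_mul hE (by fun_prop), D_exp hpsi, D_psi, D_add a1 (by fun_prop), D_mul (by fun_prop) a2,
      D_mul hh' (by fun_prop), D_const, D_hh]
    simp only [yy_ej, ej_fst]
    ring
  have ee : ∀ p, Real.exp (-2 * psi s l ω p) * (Real.exp (psi s l ω p)) ^ 2 = 1 := by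
    intro p
    rw [← Real.exp_nat_mul, ← Real.exp_add]; simp
  have k1 : ∀ p, Real.exp (-2 * psi s l ω p) * (l ^ 2 * u p ^ 2 + ∑ j, (D (ej j) u p) ^ 2)
      = l ^ 2 * v p ^ 2 + ∑ j, (D (ej j) v p + hh s l ω p * ω j * v p) ^ 2 := by
    intro p
    simp only [dj, mul_pow]
    have : u p = Real.exp (psi s l ω p) * v p := congrFun huv p
    rw [← Finset.mul_sum, this]
    linear_combination (l ^ 2 * v p ^ 2 + ∑ j, (D (ej j) v p + hh s l ω p * ω j * v p) ^ 2) * ee p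
  have k2 : ∀ p, Real.exp (-2 * psi s l ω p) * (D et u p - ∑ j, D (ej j) (D (ej j) u) p) ^ 2
      = (Pf s l ω v p) ^ 2 := by
    intro p
    have : D et u p - ∑ j, D (ej j) (D (ej j) u) p = Real.exp (psi s l ω p) * Pf s l ω v p := by
      simp only [djj]
      rw [dt, ← Finset.mul_sum, Finset.sum_add_distrib, Finset.sum_add_distrib, ← Finset.mul_sum, ← Finset.mul_sum,
        hω, ← D_eo, Pf, P2]
      ring
    rw [this]
    linear_combination (Pf s l ω v p) ^ 2 * ee p
  simp_rw [k1, k2]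
  exact hest

lemma spDeriv_eq {u : (ℝ × (Fin n → ℝ)) → ℂ} {p : (ℝ × (Fin n → ℝ))} (hu : DifferentiableAt ℝ u p) (j : Fin n) :
    spDeriv j u p = fderiv ℝ u p (ej j) := by
  unfold spDeriv
  have h1 : HasDerivAt (fun t : ℝ => ((p.1, Function.update p.2 j t) : (ℝ × (Fin n → ℝ)))) (ej j) (p.2 j) :=
    (hasDerivAt_const _ _).prodMk (hasDerivAt_update p.2 j (p.2 j))
  have h2 : HasFDerivAt u (fderiv ℝ u p) ((p.1, Function.update p.2 j (p.2 j)) : (ℝ × (Fin n → ℝ))) := by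
    simpa using hu.hasFDerivAt
  exact (h2.comp_hasDerivAt (p.2 j) h1).deriv

lemma timeDeriv_eq {u : (ℝ × (Fin n → ℝ)) → ℂ} {p : (ℝ × (Fin n → ℝ))} (hu : DifferentiableAt ℝ u p) :
    timeDeriv u p = fderiv ℝ u p et := by
  unfold timeDeriv
  have h1 : HasDerivAt (fun t : ℝ => ((t, p.2) : (ℝ × (Fin n → ℝ)))) et p.1 :=
    (hasDerivAt_id _).prodMk (hasDerivAt_const _ _)
  have h2 : HasFDerivAt u (fderiv ℝ u p) ((p.1, p.2) : (ℝ × (Fin n → ℝ))) := hu.hasFDerivAt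
  exact (h2.comp_hasDerivAt p.1 h1).deriv

lemma D_re {u : (ℝ × (Fin n → ℝ)) → ℂ} {p : (ℝ × (Fin n → ℝ))} (hu : DifferentiableAt ℝ u p) (a : (ℝ × (Fin n → ℝ))) :
    D a (fun p => (u p).re) p = (fderiv ℝ u p a).re := by
  have := (Complex.reCLM.hasFDerivAt.comp p hu.hasFDerivAt).fderiv
  unfold D
  change fderiv ℝ (⇑Complex.reCLM ∘ u) p a = _
  rw [this]; rfl

lemma D_im {u : (ℝ × (Fin n → ℝ)) → ℂ} {p : (ℝ × (Fin n → ℝ))} (hu : DifferentiableAt ℝ u p) (a : (ℝ × (Fin n → ℝ))) :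
    D a (fun p => (u p).im) p = (fderiv ℝ u p a).im := by
  have := (Complex.imCLM.hasFDerivAt.comp p hu.hasFDerivAt).fderiv
  unfold D
  change fderiv ℝ (⇑Complex.imCLM ∘ u) p a = _
  rw [this]; rfl

lemma smooth_sp {u : (ℝ × (Fin n → ℝ)) → ℂ} (hu : ContDiff ℝ (⊤ : ℕ∞) u) (j : Fin n) : ContDiff ℝ (⊤ : ℕ∞) (spDeriv j u) := by
  have : spDeriv j u = fun p => fderiv ℝ u p (ej j) := by
    funext p; exact spDeriv_eq (hu.differentiable (by simp) p) j
  rw [this]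
  exact (hu.fderiv_right (m := (⊤ : ℕ∞)) (by norm_cast)).clm_apply contDiff_const

lemma smooth_tm {u : (ℝ × (Fin n → ℝ)) → ℂ} (hu : ContDiff ℝ (⊤ : ℕ∞) u) : ContDiff ℝ (⊤ : ℕ∞) (timeDeriv u) := by
  have : timeDeriv u = fun p => fderiv ℝ u p et := by
    funext p; exact timeDeriv_eq (hu.differentiable (by simp) p)
  rw [this]
  exact (hu.fderiv_right (m := (⊤ : ℕ∞)) (by norm_cast)).clm_apply contDiff_const

lemma sp_zero {u : (ℝ × (Fin n → ℝ)) → ℂ} (hu : ContDiff ℝ (⊤ : ℕ∞) u) (j : Fin n) {p : (ℝ × (Fin n → ℝ))} (hp : p ∉ tsupport u) :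
    spDeriv j u p = 0 := by
  rw [spDeriv_eq (hu.differentiable (by simp) p) j, fderiv_of_notMem_tsupport ℝ hp]; rfl

lemma tm_zero {u : (ℝ × (Fin n → ℝ)) → ℂ} (hu : ContDiff ℝ (⊤ : ℕ∞) u) {p : (ℝ × (Fin n → ℝ))} (hp : p ∉ tsupport u) :
    timeDeriv u p = 0 := by
  rw [timeDeriv_eq (hu.differentiable (by simp) p), fderiv_of_notMem_tsupport ℝ hp]; rfl

lemma spsp_zero {u : (ℝ × (Fin n → ℝ)) → ℂ} (hu : ContDiff ℝ (⊤ : ℕ∞) u) (j : Fin n) {p : (ℝ × (Fin n → ℝ))} (hp : p ∉ tsupport u) :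
    spDeriv j (spDeriv j u) p = 0 := by
  apply sp_zero (smooth_sp hu j)
  intro h
  apply hp
  refine closure_minimal ?_ (isClosed_tsupport u) h
  intro x hx
  by_contra hxx
  exact hx (sp_zero hu j hxx)

/-- heat operator -/
noncomputable def L0 (u : (ℝ × (Fin n → ℝ)) → ℂ) (p : (ℝ × (Fin n → ℝ))) : ℂ := timeDeriv u p - ∑ j, spDeriv j (spDeriv j u) p

lemma cs_int {f : (ℝ × (Fin n → ℝ)) → ℝ} (hf : Continuous f) {K : Set (ℝ × (Fin n → ℝ))} (hK : IsCompact K) (h0 : ∀ p, p ∉ K → f p = 0) :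
    Integrable f := hf.integrable_of_hasCompactSupport (HasCompactSupport.intro hK h0)

/-- Carleman estimate for complex functions. -/
lemma complex_est (hω : ∑ j, ω j ^ 2 = 1) (hs : 1 ≤ s) (hl : 1 ≤ l) (hl2 : 4 * s ≤ l ^ 2)
    {u : (ℝ × (Fin n → ℝ)) → ℂ} (hu : ContDiff ℝ (⊤ : ℕ∞) u) (hc : HasCompactSupport u)
    (hsupp : ∀ p, u p ≠ 0 → l ≤ 2 * hh s l ω p) :
    s * ∫ p, Real.exp (-2 * psi s l ω p) * (l ^ 2 * ‖u p‖ ^ 2 + ∑ j, ‖spDeriv j u p‖ ^ 2) ≤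
      4 * ∫ p, Real.exp (-2 * psi s l ω p) * ‖L0 u p‖ ^ 2 := by
  have hE : ContDiff ℝ (⊤ : ℕ∞) (fun p => Real.exp (-2 * psi s l ω p)) :=
    (contDiff_const.mul (smooth_psi s l ω)).exp
  have hdu : ∀ p, DifferentiableAt ℝ u p := fun p => hu.differentiable (by simp) p
  have hds : ∀ j p, DifferentiableAt ℝ (spDeriv j u) p := fun j p => (smooth_sp hu j).differentiable (by simp) p
  have hr : TF (fun p => (u p).re) := ⟨Complex.reCLM.contDiff.comp hu, hc.comp_left (g := Complex.re) rfl⟩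
  have hi : TF (fun p => (u p).im) := ⟨Complex.imCLM.contDiff.comp hu, hc.comp_left (g := Complex.im) rfl⟩
  have er := real_est s l ω hω hs hl hl2 hr (fun p hp => hsupp p (by rintro h; simp [h] at hp))
  have ei := real_est s l ω hω hs hl hl2 hi (fun p hp => hsupp p (by rintro h; simp [h] at hp))
  have r1 : ∀ j, D (ej j) (fun p => (u p).re) = fun p => (spDeriv j u p).re := by
    intro j; funext p; rw [D_re (hdu p), spDeriv_eq (hdu p)]
  have m1 : ∀ j, D (ej j) (fun p => (u p).im) = fun p => (spDeriv j u p).im := by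
    intro j; funext p; rw [D_im (hdu p), spDeriv_eq (hdu p)]
  have r2 : ∀ j p, D (ej j) (D (ej j) (fun p => (u p).re)) p = (spDeriv j (spDeriv j u) p).re := by
    intro j p; rw [r1, D_re (hds j p), spDeriv_eq (hds j p)]
  have m2 : ∀ j p, D (ej j) (D (ej j) (fun p => (u p).im)) p = (spDeriv j (spDeriv j u) p).im := by
    intro j p; rw [m1, D_im (hds j p), spDeriv_eq (hds j p)]
  have r3 : ∀ p, D et (fun p => (u p).re) p = (timeDeriv u p).re := by
    intro p; rw [D_re (hdu p), timeDeriv_eq (hdu p)]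
  have m3 : ∀ p, D et (fun p => (u p).im) p = (timeDeriv u p).im := by
    intro p; rw [D_im (hdu p), timeDeriv_eq (hdu p)]
  have T1 : ∀ f : (ℝ × (Fin n → ℝ)) → ℝ, TF f →
      Integrable (fun p => Real.exp (-2 * psi s l ω p) * (l ^ 2 * f p ^ 2 + ∑ j, (D (ej j) f p) ^ 2)) := by
    intro f hf
    have a1 : TF (fun p => l ^ 2 * (f p * f p)) := TF.mul_left contDiff_const (hf.mul hf)
    have a3 := (TF.mul_left hE (a1.add (TF.sum Finset.univ fun j => (hf.D (ej j)).mul (hf.D (ej j))))).int volume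
    simpa only [sq] using a3
  have T2 : ∀ f : (ℝ × (Fin n → ℝ)) → ℝ, TF f →
      Integrable (fun p => Real.exp (-2 * psi s l ω p) * (D et f p - ∑ j, D (ej j) (D (ej j) f) p) ^ 2) := by
    intro f hf
    have a2 : TF (fun p => (-1) * ∑ j, D (ej j) (D (ej j) f) p) :=
      TF.mul_left contDiff_const (TF.sum Finset.univ fun j => (hf.D (ej j)).D (ej j))
    have a1 := (hf.D et).add a2
    have a3 := (TF.mul_left hE (a1.mul a1)).int volume
    refine a3.congr (Filter.Eventually.of_forall fun p => ?_)
    simp only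
    ring
  have k1 : ∀ p, Real.exp (-2 * psi s l ω p) * (l ^ 2 * ‖u p‖ ^ 2 + ∑ j, ‖spDeriv j u p‖ ^ 2)
      = Real.exp (-2 * psi s l ω p) * (l ^ 2 * (u p).re ^ 2 + ∑ j, (D (ej j) (fun p => (u p).re) p) ^ 2)
      + Real.exp (-2 * psi s l ω p) * (l ^ 2 * (u p).im ^ 2 + ∑ j, (D (ej j) (fun p => (u p).im) p) ^ 2) := by
    intro p
    have hn : ∀ z : ℂ, ‖z‖ ^ 2 = z.re ^ 2 + z.im ^ 2 := by
      intro z; rw [Complex.sq_norm, Complex.normSq_apply]; ring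
    simp only [r1, m1, hn, Finset.sum_add_distrib]
    ring
  have k2 : ∀ p, Real.exp (-2 * psi s l ω p) * ‖L0 u p‖ ^ 2
      = Real.exp (-2 * psi s l ω p) * (D et (fun p => (u p).re) p - ∑ j, D (ej j) (D (ej j) (fun p => (u p).re)) p) ^ 2
      + Real.exp (-2 * psi s l ω p) * (D et (fun p => (u p).im) p - ∑ j, D (ej j) (D (ej j) (fun p => (u p).im)) p) ^ 2 := by
    intro p
    have hn : ∀ z : ℂ, ‖z‖ ^ 2 = z.re ^ 2 + z.im ^ 2 := by
      intro z; rw [Complex.sq_norm, Complex.normSq_apply]; ring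
    simp only [r2, m2, r3, m3, hn, L0, Complex.sub_re, Complex.sub_im, Complex.re_sum, Complex.im_sum]
    ring
  simp_rw [k1, k2]
  rw [integral_add (T1 _ hr) (T1 _ hi), integral_add (T2 _ hr) (T2 _ hi)]
  linarith

section pert
variable {A : (ℝ × (Fin n → ℝ)) → Fin n → ℝ} {q : (ℝ × (Fin n → ℝ)) → ℂ} {m : ℝ} {Q : Set (ℝ × (Fin n → ℝ))}

lemma spA_eq (hQ : IsOpen Q) (hA : ContDiffOn ℝ 2 A Q) {p : (ℝ × (Fin n → ℝ))} (hp : p ∈ Q) (j : Fin n) :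
    spDeriv j (fun p' => (A p' j : ℂ)) p = ((fderiv ℝ A p (ej j) j : ℝ) : ℂ) := by
  have hd : DifferentiableAt ℝ A p := (hA.contDiffAt (hQ.mem_nhds hp)).differentiableAt (by simp)
  have h1 : HasFDerivAt (fun p' => A p' j) ((ContinuousLinearMap.proj j).comp (fderiv ℝ A p)) p :=
    (hasFDerivAt_pi'.1 hd.hasFDerivAt) j
  have h2 : HasFDerivAt (fun p' => (A p' j : ℂ))
      (Complex.ofRealCLM.comp ((ContinuousLinearMap.proj j).comp (fderiv ℝ A p))) p :=
    Complex.ofRealCLM.hasFDerivAt.comp p h1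
  rw [spDeriv_eq h2.differentiableAt, h2.fderiv]; rfl

lemma norm_ej (j : Fin n) : ‖(ej j : (ℝ × (Fin n → ℝ)))‖ ≤ 1 := by
  simp [ej, Prod.norm_def, Pi.norm_single]

lemma memM_bounds (hQ : IsOpen Q) (h : MemM n m Q A q) {p : (ℝ × (Fin n → ℝ))} (hp : p ∈ Q) (j : Fin n) :
    |A p j| ≤ m ∧ |fderiv ℝ A p (ej j) j| ≤ m ∧ ‖q p‖ ≤ m := by
  have h3 := h.2.2 p hp
  simp only [Finset.sum_range_succ, Finset.sum_range_zero, zero_add, norm_iteratedFDerivWithin_zero] at h3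
  rw [norm_iteratedFDerivWithin_one (𝕜 := ℝ) A (hQ.uniqueDiffWithinAt hp), fderivWithin_of_isOpen hQ hp] at h3
  have n1 := norm_nonneg (A p)
  have n2 := norm_nonneg (fderiv ℝ A p)
  have n3 := norm_nonneg (iteratedFDerivWithin ℝ 2 A Q p)
  have n4 := norm_nonneg (q p)
  have n5 := norm_nonneg (iteratedFDerivWithin ℝ 1 q Q p)
  refine ⟨(norm_le_pi_norm (A p) j).trans (by linarith), ?_, by linarith⟩
  have b1 := norm_le_pi_norm (fderiv ℝ A p (ej j)) j
  have b2 := (fderiv ℝ A p).le_opNorm (ej j)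
  have b3 := mul_le_mul_of_nonneg_left (norm_ej j) n2
  rw [Real.norm_eq_abs] at b1
  linarith

lemma LOp_eq (u : (ℝ × (Fin n → ℝ)) → ℂ) (p : (ℝ × (Fin n → ℝ))) : LOp A q u p = L0 u p
    + (q p * u p - ∑ j, (2 * (A p j : ℂ) * spDeriv j u p
        + (spDeriv j (fun p' => (A p' j : ℂ)) p + (A p j : ℂ) ^ 2) * u p)) := by
  have : ∀ j, spDeriv j (spDeriv j u) p + 2 * (A p j : ℂ) * spDeriv j u p
        + spDeriv j (fun p' => (A p' j : ℂ)) p * u p + (A p j : ℂ) ^ 2 * u p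
      = spDeriv j (spDeriv j u) p + (2 * (A p j : ℂ) * spDeriv j u p
        + (spDeriv j (fun p' => (A p' j : ℂ)) p + (A p j : ℂ) ^ 2) * u p) := fun j => by ring
  simp only [LOp, L0, this]
  rw [Finset.sum_add_distrib]
  ring

lemma LOp_zero {u : (ℝ × (Fin n → ℝ)) → ℂ} (hu : ContDiff ℝ (⊤ : ℕ∞) u) {p : (ℝ × (Fin n → ℝ))} (hp : p ∉ tsupport u) :
    LOp A q u p = 0 := by
  simp [LOp, tm_zero hu hp, sp_zero hu _ hp, spsp_zero hu _ hp, image_eq_zero_of_notMem_tsupport hp]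

lemma pert_bound (hQ : IsOpen Q) (h : MemM n m Q A q) (M : ℝ) (hM : 1 ≤ M) (hmM : m ≤ M)
    (hl : 1 ≤ l) (u : (ℝ × (Fin n → ℝ)) → ℂ) {p : (ℝ × (Fin n → ℝ))} (hp : p ∈ Q) :
    ‖L0 u p‖ ^ 2 ≤ 2 * ‖LOp A q u p‖ ^ 2 + 2 * (8 * (2 * n + 1) ^ 2 * M ^ 4) *
      (l ^ 2 * ‖u p‖ ^ 2 + ∑ j, ‖spDeriv j u p‖ ^ 2) := by
  set R := q p * u p - ∑ j, (2 * (A p j : ℂ) * spDeriv j u p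
        + (spDeriv j (fun p' => (A p' j : ℂ)) p + (A p j : ℂ) ^ 2) * u p) with hR
  have e : L0 u p = LOp A q u p - R := by rw [LOp_eq, hR]; ring
  have hM2 : M ≤ M ^ 2 := by nlinarith
  have un := norm_nonneg (u p)
  have t : ∀ j, ‖2 * (A p j : ℂ) * spDeriv j u p
        + (spDeriv j (fun p' => (A p' j : ℂ)) p + (A p j : ℂ) ^ 2) * u p‖
        ≤ 2 * M * ‖spDeriv j u p‖ + 2 * M ^ 2 * ‖u p‖ := by
    intro j
    obtain ⟨b1, b2, _⟩ := memM_bounds hQ h hp j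
    rw [spA_eq hQ h.1 hp j]
    refine (norm_add_le _ _).trans (add_le_add ?_ ?_)
    · rw [norm_mul, norm_mul, Complex.norm_real, Real.norm_eq_abs]
      refine mul_le_mul_of_nonneg_right ?_ (norm_nonneg _)
      simp only [RCLike.norm_ofNat]
      linarith
    · rw [norm_mul]
      refine mul_le_mul_of_nonneg_right ?_ un
      refine (norm_add_le _ _).trans ?_
      rw [norm_pow, Complex.norm_real, Complex.norm_real, Real.norm_eq_abs, Real.norm_eq_abs]
      have := pow_le_pow_left₀ (abs_nonneg (A p j)) (b1.trans hmM) 2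
      linarith
  have hRn : ‖R‖ ≤ 2 * M * (∑ j, ‖spDeriv j u p‖) + (2 * n + 1) * M ^ 2 * ‖u p‖ := by
    refine (norm_sub_le _ _).trans ?_
    have q1 : ‖q p * u p‖ ≤ M ^ 2 * ‖u p‖ ∨ n = 0 := by
      rcases Nat.eq_zero_or_pos n with h0 | h0
      · exact Or.inr h0
      · left
        rw [norm_mul]
        exact mul_le_mul_of_nonneg_right (((memM_bounds hQ h hp ⟨0, h0⟩).2.2.trans hmM).trans hM2) un
    have q1' : ‖q p * u p‖ ≤ M ^ 2 * ‖u p‖ := by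
      rcases q1 with h' | h0
      · exact h'
      · have h3 := h.2.2 p hp
        simp only [Finset.sum_range_succ, Finset.sum_range_zero, zero_add, norm_iteratedFDerivWithin_zero] at h3
        have n1 := norm_nonneg (A p)
        have n2 := norm_nonneg (iteratedFDerivWithin ℝ 1 A Q p)
        have n3 := norm_nonneg (iteratedFDerivWithin ℝ 2 A Q p)
        have n5 := norm_nonneg (iteratedFDerivWithin ℝ 1 q Q p)
        rw [norm_mul]
        exact mul_le_mul_of_nonneg_right (by linarith) un
    have q2 := (norm_sum_le Finset.univ _).trans (Finset.sum_le_sum fun j _ => t j)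
    have q3 : ∑ j, (2 * M * ‖spDeriv j u p‖ + 2 * M ^ 2 * ‖u p‖) =
        2 * M * (∑ j, ‖spDeriv j u p‖) + n * (2 * M ^ 2 * ‖u p‖) := by
      rw [Finset.sum_add_distrib, ← Finset.mul_sum]
      simp
    rw [q3] at q2
    linarith
  have hS := sq_sum_le_card_mul_sum_sq (s := Finset.univ) (f := fun j => ‖spDeriv j u p‖)
  simp only [Finset.card_univ, Fintype.card_fin] at hS
  have hS0 : 0 ≤ ∑ j, ‖spDeriv j u p‖ := Finset.sum_nonneg fun j _ => norm_nonneg _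
  have hG0 : 0 ≤ ∑ j, ‖spDeriv j u p‖ ^ 2 := Finset.sum_nonneg fun j _ => sq_nonneg _
  have hn0 : (0:ℝ) ≤ n := Nat.cast_nonneg n
  have h1 : ‖L0 u p‖ ^ 2 ≤ 2 * ‖LOp A q u p‖ ^ 2 + 2 * ‖R‖ ^ 2 := by
    have h0 : ‖L0 u p‖ ≤ ‖LOp A q u p‖ + ‖R‖ := by rw [e]; exact norm_sub_le _ _
    nlinarith [pow_le_pow_left₀ (norm_nonneg _) h0 2, sq_nonneg (‖LOp A q u p‖ - ‖R‖)]
  have h2 := pow_le_pow_left₀ (norm_nonneg _) hRn 2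
  generalize (∑ j, ‖spDeriv j u p‖) = S at *
  generalize (∑ j, ‖spDeriv j u p‖ ^ 2) = G at *
  have h3 : ‖R‖ ^ 2 ≤ 8 * M ^ 2 * S ^ 2 + 2 * ((2 * n + 1) * M ^ 2 * ‖u p‖) ^ 2 := by
    nlinarith [sq_nonneg (2 * M * S - (2 * n + 1) * M ^ 2 * ‖u p‖)]
  have h4 : 8 * M ^ 2 * S ^ 2 ≤ 8 * (2 * n + 1) ^ 2 * M ^ 4 * G := by
    have c1 : M ^ 2 * S ^ 2 ≤ M ^ 2 * (n * G) := mul_le_mul_of_nonneg_left hS (by positivity)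
    have c2 : M ^ 2 ≤ M ^ 4 := pow_le_pow_right₀ hM (by norm_num)
    have c3 : (n:ℝ) ≤ (2 * n + 1) ^ 2 := by nlinarith
    have c4 : M ^ 2 * (n * G) ≤ M ^ 4 * ((2 * n + 1) ^ 2 * G) := by gcongr
    linarith
  have h5 : 2 * ((2 * n + 1) * M ^ 2 * ‖u p‖) ^ 2 ≤ 8 * (2 * n + 1) ^ 2 * M ^ 4 * (l ^ 2 * ‖u p‖ ^ 2) := by
    have c1 : (1:ℝ) ≤ l ^ 2 := by nlinarith
    have c2 : ‖u p‖ ^ 2 ≤ l ^ 2 * ‖u p‖ ^ 2 := le_mul_of_one_le_left (sq_nonneg _) c1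
    have c3 : (0:ℝ) ≤ (2 * n + 1) ^ 2 * M ^ 4 := by positivity
    have c4 := mul_le_mul_of_nonneg_left c2 c3
    have c5 : 0 ≤ (2 * n + 1) ^ 2 * M ^ 4 * (l ^ 2 * ‖u p‖ ^ 2) := by positivity
    nlinarith
  linarith

lemma LOp_int (hQ : IsOpen Q) (h : MemM n m Q A q) {u : (ℝ × (Fin n → ℝ)) → ℂ} (hu : ContDiff ℝ (⊤ : ℕ∞) u)
    (hc : HasCompactSupport u) (hsub : tsupport u ⊆ Q) {w : (ℝ × (Fin n → ℝ)) → ℝ} (hw : Continuous w) :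
    Integrable (fun p => w p * ‖LOp A q u p‖ ^ 2) := by
  have hz : ∀ p, p ∉ tsupport u → w p * ‖LOp A q u p‖ ^ 2 = 0 := by
    intro p hp; rw [LOp_zero hu hp]; simp
  have cA : ∀ j, ContinuousOn (fun p => (A p j : ℂ)) Q := fun j =>
    Complex.continuous_ofReal.comp_continuousOn ((continuous_apply j).comp_continuousOn h.1.continuousOn)
  have cdA : ∀ j, ContinuousOn (fun p => spDeriv j (fun p' => (A p' j : ℂ)) p) Q := by
    intro j
    have h1 : ContinuousOn (fderiv ℝ A) Q := h.1.continuousOn_fderiv_of_isOpen hQ (by simp)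
    have h2 : ContinuousOn (fun p => fderiv ℝ A p (ej j) j) Q :=
      (continuous_apply j).comp_continuousOn (h1.clm_apply continuousOn_const)
    exact (Complex.continuous_ofReal.comp_continuousOn h2).congr fun p hp => spA_eq hQ h.1 hp j
  have c0 : ContinuousOn (LOp A q u) Q := by
    have d0 := hu.continuous
    have d1 := (smooth_tm hu).continuous
    have d2 := fun j => (smooth_sp hu j).continuous
    have d3 := fun j => (smooth_sp (smooth_sp hu j) j).continuous
    unfold LOp
    refine (d1.continuousOn.sub (continuousOn_finsetSum _ fun j _ => ?_)).add
      (h.2.1.continuousOn.mul d0.continuousOn)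
    exact (((d3 j).continuousOn.add ((continuousOn_const.mul (cA j)).mul (d2 j).continuousOn)).add
      ((cdA j).mul d0.continuousOn)).add (((cA j).pow 2).mul d0.continuousOn)
  have c1 : ContinuousOn (fun p => w p * ‖LOp A q u p‖ ^ 2) (tsupport u) :=
    hw.continuousOn.mul ((c0.mono hsub).norm.pow 2)
  exact (c1.integrableOn_compact hc).integrable_of_forall_notMem_eq_zero hz

end pert

lemma yy_bound (hω : ∑ j, ω j ^ 2 = 1) (p : (ℝ × (Fin n → ℝ))) (r : ℝ) (hr : ‖p.2‖ ≤ r) : |yy ω p| ≤ n * r := by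
  have h1 : ∀ j, |ω j| ≤ 1 := by
    intro j
    rw [← sq_le_one_iff_abs_le_one, ← hω]
    exact Finset.single_le_sum (f := fun j => ω j ^ 2) (fun i _ => sq_nonneg _) (Finset.mem_univ j)
  have h2 : ∀ j, |p.2 j * ω j| ≤ r := by
    intro j
    rw [abs_mul]
    have := norm_le_pi_norm p.2 j
    rw [Real.norm_eq_abs] at this
    nlinarith [h1 j, abs_nonneg (p.2 j), abs_nonneg (ω j)]
  refine (Finset.abs_sum_le_sum_abs _ _).trans ((Finset.sum_le_sum fun j _ => h2 j).trans ?_)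
  simp

end base
end Carl


/-- **Interior Carleman estimate** for the convection–diffusion operator. -/
theorem interior_carleman_estimate
    (n : ℕ) (hn : 2 ≤ n) (Ω : Set (Fin n → ℝ)) (hΩo : IsOpen Ω)
    (hΩb : Bornology.IsBounded Ω) (T : ℝ) (hT : 0 < T) (m : ℝ) :
    ∃ lam₁ C : ℝ, 0 < lam₁ ∧ 0 < C ∧
      ∀ (A : ℝ × (Fin n → ℝ) → Fin n → ℝ) (q : ℝ × (Fin n → ℝ) → ℂ),
        MemM n m (Set.Ioo 0 T ×ˢ Ω) A q →
        ∀ ω : Fin n → ℝ, (∑ j, (ω j) ^ 2) = 1 →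
        ∀ u : ℝ × (Fin n → ℝ) → ℂ,
          ContDiff ℝ (⊤ : ℕ∞) u → HasCompactSupport u →
          tsupport u ⊆ Set.Ioo 0 T ×ˢ Ω →
        ∀ lam : ℝ, lam₁ ≤ lam →
          (∫ p in Set.Ioo 0 T ×ˢ Ω,
              Real.exp (-2 * phiW lam ω p) *
                (lam ^ 2 * ‖u p‖ ^ 2 + ∑ j, ‖spDeriv j u p‖ ^ 2))
            ≤ C * ∫ p in Set.Ioo 0 T ×ˢ Ω,
                Real.exp (-2 * phiW lam ω p) * ‖LOp A q u p‖ ^ 2 := by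
  obtain ⟨r, hr⟩ := hΩb.exists_norm_le
  set M : ℝ := max m 1 with hMdef
  set B : ℝ := 8 * (2 * n + 1) ^ 2 * M ^ 4 with hB
  set s : ℝ := 16 * B with hs
  set R : ℝ := n * |r| with hR
  have hM1 : 1 ≤ M := le_max_right _ _
  have hmM : m ≤ M := le_max_left _ _
  have hn0 : (0:ℝ) ≤ n := Nat.cast_nonneg n
  have hB1 : 1 ≤ B := by
    have a1 : (1:ℝ) ≤ (2 * n + 1) ^ 2 := by nlinarith
    have a2 : 1 ≤ M ^ 4 := one_le_pow₀ hM1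
    rw [hB]; nlinarith
  have hs1 : 1 ≤ s := by linarith
  have hR0 : 0 ≤ R := by positivity
  have hsR : 0 ≤ s * R := by positivity
  refine ⟨1 + 4 * s + 2 * (s * R), Real.exp (s * R ^ 2), by positivity, Real.exp_pos _, ?_⟩
  intro A q hmem ω hω u hu hc hsub l hll
  have hl : 1 ≤ l := by linarith
  have hl2 : 4 * s ≤ l ^ 2 := by nlinarith
  set Q : Set (ℝ × (Fin n → ℝ)) := Set.Ioo 0 T ×ˢ Ω with hQdef
  have hQ : IsOpen Q := isOpen_Ioo.prod hΩo
  have hy : ∀ p ∈ tsupport u, |Carl.yy ω p| ≤ R := by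
    intro p hp
    exact Carl.yy_bound ω hω p |r| ((hr _ (hsub hp).2).trans (le_abs_self r))
  have hsupp : ∀ p, u p ≠ 0 → l ≤ 2 * Carl.hh s l ω p := by
    intro p hp
    have h1 := (abs_le.1 (hy p (subset_tsupport u hp))).2
    have h2 := mul_le_mul_of_nonneg_left h1 (by linarith : (0:ℝ) ≤ s)
    unfold Carl.hh
    linarith
  have est := Carl.complex_est s l ω hω hs1 hl hl2 hu hc hsupp
  have hphi : ∀ p, Carl.psi s l ω p = phiW l ω p - s / 2 * (Carl.yy ω p * Carl.yy ω p) := fun p => rfl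
  have cpsi : Continuous (fun p => Real.exp (-2 * Carl.psi s l ω p)) :=
    Real.continuous_exp.comp (continuous_const.mul (Carl.smooth_psi s l ω).continuous)
  have cphi : Continuous (fun p => Real.exp (-2 * phiW l ω p)) := by
    unfold phiW; fun_prop
  have cN : Continuous (fun p => l ^ 2 * ‖u p‖ ^ 2 + ∑ j, ‖spDeriv j u p‖ ^ 2) := by
    have d2 := fun j => (Carl.smooth_sp hu j).continuous
    exact (continuous_const.mul (hu.continuous.norm.pow 2)).add
      (continuous_finsetSum _ fun j _ => (d2 j).norm.pow 2)
  have zN : ∀ p, p ∉ tsupport u → l ^ 2 * ‖u p‖ ^ 2 + ∑ j, ‖spDeriv j u p‖ ^ 2 = 0 := by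
    intro p hp
    simp [Carl.sp_zero hu _ hp, image_eq_zero_of_notMem_tsupport hp]
  have nN : ∀ p, 0 ≤ l ^ 2 * ‖u p‖ ^ 2 + ∑ j, ‖spDeriv j u p‖ ^ 2 := fun p =>
    add_nonneg (by positivity) (Finset.sum_nonneg fun j _ => sq_nonneg _)
  have iN : Integrable (fun p => Real.exp (-2 * Carl.psi s l ω p) *
      (l ^ 2 * ‖u p‖ ^ 2 + ∑ j, ‖spDeriv j u p‖ ^ 2)) :=
    Carl.cs_int (cpsi.mul cN) hc (fun p hp => by
      show _ * _ = _
      rw [zN p hp, mul_zero])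
  have iN' : Integrable (fun p => Real.exp (-2 * phiW l ω p) *
      (l ^ 2 * ‖u p‖ ^ 2 + ∑ j, ‖spDeriv j u p‖ ^ 2)) :=
    Carl.cs_int (cphi.mul cN) hc (fun p hp => by
      show _ * _ = _
      rw [zN p hp, mul_zero])
  have iL := Carl.LOp_int hQ hmem hu hc hsub cpsi
  have iL' := Carl.LOp_int hQ hmem hu hc hsub cphi
  have z0 : ∀ p, p ∉ tsupport u → Carl.L0 u p = 0 := by
    intro p hp
    simp [Carl.L0, Carl.tm_zero hu hp, Carl.spsp_zero hu _ hp]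
  have i0 : Integrable (fun p => Real.exp (-2 * Carl.psi s l ω p) * ‖Carl.L0 u p‖ ^ 2) := by
    refine Carl.cs_int (cpsi.mul ?_) hc (fun p hp => by simp [z0 p hp])
    have d1 := (Carl.smooth_tm hu).continuous
    have d3 := fun j => (Carl.smooth_sp (Carl.smooth_sp hu j) j).continuous
    exact ((d1.sub (continuous_finsetSum _ fun j _ => d3 j)).norm.pow 2)
  -- restrict to the whole space
  rw [setIntegral_eq_integral_of_forall_compl_eq_zero (fun p hp => by
      rw [zN p (fun h => hp (hsub h)), mul_zero]),
    setIntegral_eq_integral_of_forall_compl_eq_zero (fun p hp => by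
      rw [Carl.LOp_zero hu (fun h => hp (hsub h))]; simp)]
  have step1 := integral_mono i0 ((iL.const_mul 2).add (iN.const_mul (2 * B))) (fun p => by
    simp only [Pi.add_apply]
    by_cases hp : p ∈ tsupport u
    · have := mul_le_mul_of_nonneg_left (Carl.pert_bound l hQ hmem M hM1 hmM hl u (hsub hp))
        (Real.exp_pos (-2 * Carl.psi s l ω p)).le
      rw [← hB] at this
      linarith
    · rw [z0 p hp, zN p hp, Carl.LOp_zero hu hp]; simp)
  rw [integral_add' (iL.const_mul 2) (iN.const_mul (2 * B)), integral_const_mul, integral_const_mul] at step1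
  have step2 : ∫ p, Real.exp (-2 * phiW l ω p) * (l ^ 2 * ‖u p‖ ^ 2 + ∑ j, ‖spDeriv j u p‖ ^ 2) ≤
      ∫ p, Real.exp (-2 * Carl.psi s l ω p) * (l ^ 2 * ‖u p‖ ^ 2 + ∑ j, ‖spDeriv j u p‖ ^ 2) := by
    refine integral_mono iN' iN fun p => mul_le_mul_of_nonneg_right (Real.exp_le_exp.2 ?_) (nN p)
    rw [hphi]
    have := mul_nonneg (by linarith : (0:ℝ) ≤ s) (mul_self_nonneg (Carl.yy ω p))
    linarith
  have step3 : ∫ p, Real.exp (-2 * Carl.psi s l ω p) * ‖LOp A q u p‖ ^ 2 ≤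
      Real.exp (s * R ^ 2) * ∫ p, Real.exp (-2 * phiW l ω p) * ‖LOp A q u p‖ ^ 2 := by
    rw [← integral_const_mul]
    refine integral_mono iL (iL'.const_mul _) fun p => ?_
    by_cases hp : p ∈ tsupport u
    · simp only
      rw [← mul_assoc, ← Real.exp_add]
      refine mul_le_mul_of_nonneg_right (Real.exp_le_exp.2 ?_) (sq_nonneg _)
      rw [hphi]
      have h1 : Carl.yy ω p * Carl.yy ω p ≤ R ^ 2 := by
        have := pow_le_pow_left₀ (abs_nonneg _) (hy p hp) 2
        rwa [sq_abs, sq] at this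
      have := mul_le_mul_of_nonneg_left h1 (by linarith : (0:ℝ) ≤ s)
      linarith
    · simp [Carl.LOp_zero hu hp]
  have step4 : ∫ p, Real.exp (-2 * Carl.psi s l ω p) * (l ^ 2 * ‖u p‖ ^ 2 + ∑ j, ‖spDeriv j u p‖ ^ 2) ≤
      ∫ p, Real.exp (-2 * Carl.psi s l ω p) * ‖LOp A q u p‖ ^ 2 := by
    have n1 : 0 ≤ ∫ p, Real.exp (-2 * Carl.psi s l ω p) * (l ^ 2 * ‖u p‖ ^ 2 + ∑ j, ‖spDeriv j u p‖ ^ 2) :=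
      integral_nonneg fun p => mul_nonneg (Real.exp_pos _).le (nN p)
    have key : ∀ N RL I0 : ℝ, 0 ≤ N → s * N ≤ 4 * I0 → I0 ≤ 2 * RL + 2 * B * N → N ≤ RL := by
      intro N RL I0 h0 h1 h2
      have h3 : s * N = 16 * (B * N) := by rw [hs]; ring
      have h4 := le_mul_of_one_le_left h0 hB1
      linarith
    exact key _ _ _ n1 est step1
  exact step2.trans (step4.trans step3)
end

section
/- Transport equation for the principal amplitude B_g: Let D : ℝ^{1+n} → ℝⁿ be a C² vector field with compact support, A : ℝ^{1+n} → ℝⁿ a C¹ vector field with compact support, ω ∈ ℝⁿ a unit vector, and (τ,ξ) ∈ ℝ × ℝⁿ with ξ ≠ 0 and ω·ξ = 0. Define g(t,x) = ∫_ℝ ω·D(t, x + sω) ds and h(t,x) = (ξ/|ξ|)·∇ₓ( e^{−i(τt + ξ·x)} e^{g(t,x)} ). Then: (i) ω·∇ₓ h(t,x) = 0 for all (t,x), i.e. h is constant along spatial lines in the direction ω; and (ii) for any η ∈ C¹(ℝ), the function B_g(t,x) = η(t) h(t,x) e^{∫₀^∞ ω·A(t,x+sω) ds} satisfies ω·(∇ₓ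 + A) B_g = 0 on ℝ^{1+n}. -/
open MeasureTheory Set

/-- `g(t,x) = ∫_ℝ ω·D(t, x + sω) ds`. -/
noncomputable def lineIntAll {n : ℕ} (D : ℝ × (Fin n → ℝ) → Fin n → ℝ) (ω : Fin n → ℝ)
    (t : ℝ) (x : Fin n → ℝ) : ℝ :=
  ∫ s : ℝ, ∑ j, ω j * D (t, fun i => x i + s * ω i) j

/-- `∫₀^∞ ω·A(t, x + sω) ds`. -/
noncomputable def lineIntPos {n : ℕ} (A : ℝ × (Fin n → ℝ) → Fin n → ℝ) (ω : Fin n → ℝ)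
    (t : ℝ) (x : Fin n → ℝ) : ℝ :=
  ∫ s in Set.Ioi (0 : ℝ), ∑ j, ω j * A (t, fun i => x i + s * ω i) j

/-- `h(t,x) = (ξ/|ξ|)·∇ₓ( e^{−i(τt + ξ·x)} e^{g(t,x)} )`. -/
noncomputable def ampH {n : ℕ} (D : ℝ × (Fin n → ℝ) → Fin n → ℝ) (ω : Fin n → ℝ)
    (τ : ℝ) (ξ : Fin n → ℝ) (t : ℝ) (x : Fin n → ℝ) : ℂ :=
  fderiv ℝ
    (fun y : Fin n → ℝ =>
      Complex.exp (-Complex.I * ((τ * t + ∑ j, ξ j * y j : ℝ) : ℂ)) *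
        Complex.exp ((lineIntAll D ω t y : ℝ) : ℂ))
    x (fun j => ξ j / Real.sqrt (∑ i, (ξ i) ^ 2))

/-- The principal amplitude `B_g(t,x) = η(t) h(t,x) e^{∫₀^∞ ω·A(t,x+sω) ds}`. -/
noncomputable def ampBg {n : ℕ} (D A : ℝ × (Fin n → ℝ) → Fin n → ℝ) (ω : Fin n → ℝ)
    (τ : ℝ) (ξ : Fin n → ℝ) (η : ℝ → ℝ) (t : ℝ) (x : Fin n → ℝ) : ℂ :=
  (η t : ℂ) * ampH D ω τ ξ t x * Complex.exp ((lineIntPos A ω t x : ℝ) : ℂ)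


theorem aux_shift {n : ℕ} (ω x : Fin n → ℝ) (s : ℝ) :
    (fun i => x i + s * ω i) = x + s • ω := by
  ext i; simp

theorem aux_contDiff {n : ℕ} {m : ℕ∞} (F : (Fin n → ℝ) → ℝ) (hF : ContDiff ℝ m F) (M : ℝ)
    (hM : ∀ y, M < ‖y‖ → F y = 0) (ω : Fin n → ℝ) (hω : ω ≠ 0) (f : ℝ → ℝ)
    (hf : LocallyIntegrable f volume) :
    ContDiff ℝ m (fun x => ∫ s, f s * F (x + s • ω)) := by
  have hω' : 0 < ‖ω‖ := norm_pos_iff.mpr hω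
  rw [contDiff_iff_contDiffAt]
  intro x₀
  have key := contDiffOn_convolution_right_with_param (𝕜 := ℝ) (n := m) (μ := volume)
    (ContinuousLinearMap.mul ℝ ℝ) (f := f)
    (g := fun (p : Fin n → ℝ) (r : ℝ) => F (p - r • ω))
    (s := Metric.ball 0 (‖x₀‖ + 1)) (k := Metric.closedBall 0 ((‖x₀‖ + 1 + M) / ‖ω‖))
    Metric.isOpen_ball (isCompact_closedBall _ _) (by
      intro p r hp hr
      apply hM
      simp only [Metric.mem_ball, Metric.mem_closedBall, dist_zero_right, not_le] at hp hr
      rw [div_lt_iff₀ hω', ← norm_smul] at hr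
      have := norm_sub_norm_le (r • ω) p
      rw [norm_sub_rev] at this
      linarith) hf (by
      apply ContDiff.contDiffOn
      change ContDiff ℝ m (fun q : (Fin n → ℝ) × ℝ => F (q.1 - q.2 • ω))
      apply hF.comp
      fun_prop)
  have h2 : ContDiffAt ℝ m (fun x : Fin n → ℝ => ((x, (0:ℝ)) : (Fin n → ℝ) × ℝ)) x₀ := by
    fun_prop
  have h3 := (key.contDiffAt (x := (x₀, (0:ℝ))) ((Metric.isOpen_ball.prod isOpen_univ).mem_nhds
    (by simp))).comp x₀ h2
  refine h3.congr_of_eventuallyEq (Filter.Eventually.of_forall fun x => ?_)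
  simp [convolution]

theorem aux_F {n : ℕ} {m : ℕ∞} (D : ℝ × (Fin n → ℝ) → Fin n → ℝ)
    (hD : ContDiff ℝ m D) (hDc : HasCompactSupport D) (ω : Fin n → ℝ) (t : ℝ) :
    ContDiff ℝ m (fun y => ∑ j, ω j * D (t, y) j) ∧
    ∃ M : ℝ, ∀ y, M < ‖y‖ → (∑ j, ω j * D (t, y) j) = 0 := by
  constructor
  · apply ContDiff.sum
    intro j _
    apply contDiff_const.mul
    have : ContDiff ℝ m (fun y => D (t, y)) := hD.comp (by fun_prop)
    exact contDiff_pi.mp this j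
  · obtain ⟨M, hM⟩ := hDc.isCompact.isBounded.exists_norm_le
    refine ⟨M, fun y hy => ?_⟩
    have : D (t, y) = 0 := by
      by_contra h
      have h1 := hM (t, y) (subset_tsupport _ h)
      have := norm_snd_le (t, y)
      simp only at this
      linarith
    simp [this]

theorem aux_all {n : ℕ} {m : ℕ∞} (D : ℝ × (Fin n → ℝ) → Fin n → ℝ)
    (hD : ContDiff ℝ m D) (hDc : HasCompactSupport D) (ω : Fin n → ℝ) (hω : ω ≠ 0) (t : ℝ) :
    ContDiff ℝ m (fun x => lineIntAll D ω t x) := by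
  obtain ⟨h1, M, hM⟩ := aux_F D hD hDc ω t
  have := aux_contDiff _ h1 M hM ω hω (fun _ => 1) (locallyIntegrable_const 1)
  simpa only [lineIntAll, aux_shift, one_mul] using this

theorem aux_pos {n : ℕ} {m : ℕ∞} (D : ℝ × (Fin n → ℝ) → Fin n → ℝ)
    (hD : ContDiff ℝ m D) (hDc : HasCompactSupport D) (ω : Fin n → ℝ) (hω : ω ≠ 0) (t : ℝ) :
    ContDiff ℝ m (fun x => lineIntPos D ω t x) := by
  obtain ⟨h1, M, hM⟩ := aux_F D hD hDc ω t
  have := aux_contDiff _ h1 M hM ω hω ((Ioi (0:ℝ)).indicator fun _ => 1)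
    ((locallyIntegrable_const 1).indicator measurableSet_Ioi)
  convert this using 2 with x
  rw [lineIntPos, ← integral_indicator measurableSet_Ioi]
  congr 1
  ext s
  by_cases hs : s ∈ Ioi (0:ℝ) <;> simp only [aux_shift, indicator, hs, if_true, if_false] <;> simp

theorem aux_all_inv {n : ℕ} (D : ℝ × (Fin n → ℝ) → Fin n → ℝ) (ω : Fin n → ℝ) (t r : ℝ)
    (x : Fin n → ℝ) : lineIntAll D ω t (x + r • ω) = lineIntAll D ω t x := by
  simp only [lineIntAll, aux_shift]
  rw [← integral_add_right_eq_self (fun s : ℝ => ∑ j, ω j * D (t, x + s • ω) j) r]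
  congr 1
  ext s
  rw [add_assoc, ← add_smul, add_comm r s]

theorem aux_H_inv {n : ℕ} (D : ℝ × (Fin n → ℝ) → Fin n → ℝ) (ω : Fin n → ℝ)
    (τ : ℝ) (ξ : Fin n → ℝ) (hωξ : (∑ j, ω j * ξ j) = 0) (t r : ℝ)
    (x : Fin n → ℝ) : ampH D ω τ ξ t (x + r • ω) = ampH D ω τ ξ t x := by
  unfold ampH
  rw [← fderiv_comp_add_right]
  congr 2
  ext y
  rw [aux_all_inv]
  have : ∑ j, ξ j * (y + r • ω) j = ∑ j, ξ j * y j := by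
    have h : ∑ j, ξ j * (y + r • ω) j = ∑ j, ξ j * y j + r * ∑ j, ω j * ξ j := by
      rw [Finset.mul_sum, ← Finset.sum_add_distrib]
      refine Finset.sum_congr rfl fun j _ => ?_
      simp; ring
    rw [h, hωξ]; simp
  rw [this]

theorem aux_H_diff {n : ℕ} (D : ℝ × (Fin n → ℝ) → Fin n → ℝ) (hD : ContDiff ℝ 2 D)
    (hDc : HasCompactSupport D) (ω : Fin n → ℝ) (hω : ω ≠ 0)
    (τ : ℝ) (ξ : Fin n → ℝ) (t : ℝ) :
    Differentiable ℝ (fun x => ampH D ω τ ξ t x) := by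
  unfold ampH
  have h1 : ContDiff ℝ 2 (fun x => lineIntAll D ω t x) := aux_all (m := 2) D hD hDc ω hω t
  have h2 : ContDiff ℝ 2 (fun y : Fin n → ℝ =>
      Complex.exp (-Complex.I * ((τ * t + ∑ j, ξ j * y j : ℝ) : ℂ)) *
        Complex.exp ((lineIntAll D ω t y : ℝ) : ℂ)) := by
    have h3 : ContDiff ℝ 2 (fun y : Fin n → ℝ => ((τ * t + ∑ j, ξ j * y j : ℝ) : ℂ)) :=
      Complex.ofRealCLM.contDiff.comp 
        (by fun_prop : ContDiff ℝ 2 (fun y : Fin n → ℝ => τ * t + ∑ j, ξ j * y j))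
    have h4 : ContDiff ℝ 2 (fun y : Fin n → ℝ => ((lineIntAll D ω t y : ℝ) : ℂ)) :=
      Complex.ofRealCLM.contDiff.comp h1
    exact (contDiff_const.mul h3).cexp.mul h4.cexp
  have h5 := (h2.fderiv_right (m := 1) (by norm_num [one_add_one_eq_two])).differentiable (by simp)
  exact h5.clm_apply (differentiable_const _)

theorem aux_pos_deriv {n : ℕ} (A : ℝ × (Fin n → ℝ) → Fin n → ℝ)
    (hA : ContDiff ℝ 1 A) (hAc : HasCompactSupport A) (ω : Fin n → ℝ) (hω : ω ≠ 0) (t : ℝ)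
    (x : Fin n → ℝ) :
    HasDerivAt (fun r : ℝ => lineIntPos A ω t (x + r • ω)) (-∑ j, ω j * A (t, x) j) 0 := by
  obtain ⟨h1, M, hM⟩ := aux_F (m := 1) A hA hAc ω t
  set φ : ℝ → ℝ := fun s => ∑ j, ω j * A (t, x + s • ω) j with hφ
  have hω' : 0 < ‖ω‖ := norm_pos_iff.mpr hω
  have hc : Continuous φ := h1.continuous.comp (by fun_prop : Continuous fun s : ℝ => x + s • ω)
  have hcs : HasCompactSupport φ := by
    refine HasCompactSupport.intro (isCompact_closedBall (0:ℝ) ((‖x‖ + M) / ‖ω‖)) fun r hr => ?_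
    apply hM
    simp only [Metric.mem_closedBall, dist_zero_right, not_le] at hr
    rw [div_lt_iff₀ hω', ← norm_smul] at hr
    have := norm_sub_norm_le (r • ω) (-x)
    rw [norm_neg, sub_neg_eq_add, add_comm (r • ω)] at this
    linarith
  have hi : Integrable φ := hc.integrable_of_hasCompactSupport hcs
  have heq : (fun r : ℝ => lineIntPos A ω t (x + r • ω)) =
      fun r => (∫ s in Ioi (0:ℝ), φ s) - ∫ s in (0:ℝ)..r, φ s := by
    ext r
    rw [← intervalIntegral.integral_interval_add_Ioi (b := r) hi.integrableOn hi.integrableOn,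
      add_sub_cancel_left,
      ← (measurePreserving_add_right volume r).setIntegral_preimage_emb
        (measurableEmbedding_addRight r) φ (Ioi r)]
    simp only [lineIntPos, aux_shift, preimage_add_const_Ioi, sub_self]
    congr 1
    ext s
    rw [add_assoc, ← add_smul, add_comm r s]
  rw [heq]
  have h := (intervalIntegral.integral_hasDerivAt_right (a := 0) (b := 0)
    (hc.intervalIntegrable _ _) (hc.stronglyMeasurableAtFilter _ _) hc.continuousAt)
  have h' := h.const_sub (∫ s in Ioi (0:ℝ), φ s)
  simpa [hφ] using h'

theorem aux_line {n : ℕ} (f : (Fin n → ℝ) → ℂ) (x ω : Fin n → ℝ) (c : ℂ)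
    (hf : DifferentiableAt ℝ f x) (h : HasDerivAt (fun r : ℝ => f (x + r • ω)) c 0) :
    fderiv ℝ f x ω = c := by
  have h2 : HasLineDerivAt ℝ f (fderiv ℝ f x ω) x ω := hf.hasFDerivAt.hasLineDerivAt ω
  exact HasDerivAt.unique h2 h

/-- **Transport equation for the principal amplitude `B_g`**:
(i) `ω·∇ₓ h = 0`; (ii) `ω·(∇ₓ + A) B_g = 0`. -/
theorem transport_equation_principal_amplitude
    (n : ℕ) (D : ℝ × (Fin n → ℝ) → Fin n → ℝ)
    (hD : ContDiff ℝ 2 D) (hDc : HasCompactSupport D)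
    (A : ℝ × (Fin n → ℝ) → Fin n → ℝ)
    (hA : ContDiff ℝ 1 A) (hAc : HasCompactSupport A)
    (ω : Fin n → ℝ) (hω : (∑ j, (ω j) ^ 2) = 1)
    (τ : ℝ) (ξ : Fin n → ℝ) (hξ : ξ ≠ 0) (hωξ : (∑ j, ω j * ξ j) = 0) :
    (∀ (t : ℝ) (x : Fin n → ℝ), fderiv ℝ (fun y => ampH D ω τ ξ t y) x ω = 0) ∧
    ∀ η : ℝ → ℝ, ContDiff ℝ 1 η →
      ∀ (t : ℝ) (x : Fin n → ℝ),
        fderiv ℝ (fun y => ampBg D A ω τ ξ η t y) x ω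
          + ((∑ j, ω j * A (t, x) j : ℝ) : ℂ) * ampBg D A ω τ ξ η t x = 0 := by
  have hω0 : ω ≠ 0 := by
    rintro rfl
    simp at hω
  refine ⟨fun t x => ?_, fun η _ t x => ?_⟩
  · apply aux_line _ _ _ _ (aux_H_diff D hD hDc ω hω0 τ ξ t x)
    simp only [aux_H_inv D ω τ ξ hωξ]
    exact hasDerivAt_const _ _
  · have hP : Differentiable ℝ (fun y => lineIntPos A ω t y) :=
      (aux_pos (m := 1) A hA hAc ω hω0 t).differentiable (by simp)
    have hPc : Differentiable ℝ (fun y => ((lineIntPos A ω t y : ℝ) : ℂ)) :=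
      Complex.ofRealCLM.differentiable.comp hP
    have hB : Differentiable ℝ (fun y => ampBg D A ω τ ξ η t y) :=
      ((aux_H_diff D hD hDc ω hω0 τ ξ t).const_mul (η t : ℂ)).mul hPc.cexp
    have hd := (((aux_pos_deriv A hA hAc ω hω0 t x).ofReal_comp).cexp).const_mul
      ((η t : ℂ) * ampH D ω τ ξ t x)
    have hl := aux_line _ x ω _ (hB x) (by
      simp only [ampBg, aux_H_inv D ω τ ξ hωξ]
      exact hd)
    rw [hl]
    simp only [ampBg, zero_smul, add_zero, Complex.ofReal_neg]
    ring
end
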